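/- For every integer n ≥ 3, every real c > 0 and every x ≥ 0, one has γ(x) > (9/5)·√(n−1)·c. -/

import Mathlib

open Real Filter

noncomputable def alphaF (n : ℕ) (c : ℝ) (x : ℝ) : ℝ :=
  (n : ℝ) * c + ((n : ℝ) / (2 * ((n : ℝ) - 1))) * x
    - (((n : ℝ) - 2) / (2 * ((n : ℝ) - 1))) * Real.sqrt (x ^ 2 + 4 * ((n : ℝ) - 1) * c * x)

noncomputable def yn (n : ℕ) : ℝ :=
  4 * (1 - (n : ℝ)) + (2 * ((n : ℝ) ^ 2 - 4) / Real.sqrt (2 * (n : ℝ) - 5)) *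
    Real.cos ((1 / 3) * Real.arctan (((n : ℝ) ^ 2 - 4 * (n : ℝ) + 6) /
      (2 * ((n : ℝ) - 1) * Real.sqrt (2 * (n : ℝ) - 5))))

noncomputable def x0 (n : ℕ) (c : ℝ) : ℝ := yn n * c

noncomputable def betaF (n : ℕ) (c : ℝ) (x : ℝ) : ℝ :=
  alphaF n c (x0 n c) + deriv (alphaF n c) (x0 n c) * (x - x0 n c)
    + (1 / 2) * deriv (deriv (alphaF n c)) (x0 n c) * (x - x0 n c) ^ 2

noncomputable def gammaF (n : ℕ) (c : ℝ) (x : ℝ) : ℝ :=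
  if x0 n c ≤ x then alphaF n c x else betaF n c x

noncomputable def gammaF' (n : ℕ) (c : ℝ) (x : ℝ) : ℝ :=
  derivWithin (gammaF n c) (Set.Ici 0) x

noncomputable def gammaF'' (n : ℕ) (c : ℝ) (x : ℝ) : ℝ :=
  derivWithin (gammaF' n c) (Set.Ici 0) x

noncomputable def omegaF (n : ℕ) (c : ℝ) (x : ℝ) : ℝ :=
  (x ^ 2 / Real.sqrt (x ^ 2 + 4 * ((n : ℝ) - 1) * c * x)) *
    ((1 + (n : ℝ) ^ 2 * c / x) *
      (((n : ℝ) / ((n : ℝ) - 2) - (1 + 4 * ((n : ℝ) - 1) * c / x) ^ (-(1 / 2) : ℝ)) /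
       ((n : ℝ) / ((n : ℝ) - 2) + (1 + 4 * ((n : ℝ) - 1) * c / x) ^ (-(1 / 2) : ℝ)))) ^ 2

/-- The rational parametrization of `[0, ∞)` that makes the square root in `alphaF` rational. -/
lemma exists_param {w c x : ℝ} (hw : 0 < w) (hc : 0 < c) (hx : 0 ≤ x) :
    ∃ v, 0 < v ∧ v ≤ w ∧ x = c * w * (w - v) ^ 2 / v := by
  have hq : 0 ≤ x / (c * w) := by positivity
  set q := x / (c * w) with hqdef
  have hxq : x = c * w * q := by rw [hqdef]; field_simp
  have hsq : Real.sqrt (q ^ 2 + 4 * w * q) ^ 2 = q ^ 2 + 4 * w * q := Real.sq_sqrt (by positivity)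
  have hs0 := Real.sqrt_nonneg (q ^ 2 + 4 * w * q)
  set s := Real.sqrt (q ^ 2 + 4 * w * q)
  have hlt : s < q + 2 * w := by nlinarith
  have hge : q ≤ s := by nlinarith [mul_nonneg hw.le hq]
  refine ⟨(q + 2 * w - s) / 2, by linarith, by linarith, ?_⟩
  have hv : q + 2 * w - s ≠ 0 := by linarith
  rw [eq_div_iff (by linarith), hxq]
  linear_combination (-c * w / 4) * hsq

lemma sqrt_param {w c v x : ℝ} (hc : 0 < c) (hv : 0 < v) (hvw : v ≤ w)
    (hx : x = c * w * (w - v) ^ 2 / v) :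
    Real.sqrt (x ^ 2 + 4 * w ^ 2 * c * x) = c * w * (w ^ 2 - v ^ 2) / v := by
  have h1 : 0 ≤ w ^ 2 - v ^ 2 := by nlinarith
  have hw : 0 < w := by linarith
  rw [show x ^ 2 + 4 * w ^ 2 * c * x = (c * w * (w ^ 2 - v ^ 2) / v) ^ 2 by
    rw [hx]; field_simp; ring]
  exact Real.sqrt_sq (by positivity)

lemma alphaF_param {n : ℕ} {w c v x : ℝ} (hn : (n : ℝ) - 1 = w ^ 2) (hc : 0 < c) (hv : 0 < v)
    (hvw : v ≤ w) (hx : x = c * w * (w - v) ^ 2 / v) :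
    alphaF n c x = c * w * (v + 1 / v) := by
  have hw : 0 < w := by linarith
  have hn' : (n : ℝ) = w ^ 2 + 1 := by linarith
  rw [alphaF, hn, sqrt_param hc hv hvw hx, hx, hn']
  field_simp
  ring

lemma hasDerivAt_sqrt_quadratic {a x : ℝ} (h : 0 < x ^ 2 + a * x) :
    HasDerivAt (fun t => Real.sqrt (t ^ 2 + a * t))
      ((2 * x + a) / (2 * Real.sqrt (x ^ 2 + a * x))) x := by
  have h1 : HasDerivAt (fun t : ℝ => t ^ 2 + a * t) (2 * x + a) x := by
    have h2 := (hasDerivAt_pow 2 x).add ((hasDerivAt_id x).const_mul a)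
    norm_num at h2
    exact h2
  exact h1.sqrt h.ne'

lemma hasDerivAt_alphaF {n : ℕ} {c x : ℝ} (hn : 1 < (n : ℝ)) (hc : 0 < c) (hx : 0 < x) :
    HasDerivAt (alphaF n c) ((n : ℝ) / (2 * ((n : ℝ) - 1)) - (((n : ℝ) - 2) / (2 * ((n : ℝ) - 1))) *
      ((2 * x + 4 * ((n : ℝ) - 1) * c) /
        (2 * Real.sqrt (x ^ 2 + 4 * ((n : ℝ) - 1) * c * x)))) x := by
  have hm : 0 < (n : ℝ) - 1 := by linarith
  have h := hasDerivAt_sqrt_quadratic (a := 4 * ((n : ℝ) - 1) * c) (x := x) (by positivity)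
  have h1 := (((hasDerivAt_id x).const_mul ((n : ℝ) / (2 * ((n : ℝ) - 1)))).const_add
    ((n : ℝ) * c)).sub (h.const_mul (((n : ℝ) - 2) / (2 * ((n : ℝ) - 1))))
  rw [mul_one] at h1
  exact h1

lemma deriv_alphaF_param {n : ℕ} {w c v x : ℝ} (hn : (n : ℝ) - 1 = w ^ 2) (hc : 0 < c)
    (hv : 0 < v) (hvw : v < w) (hx : x = c * w * (w - v) ^ 2 / v) :
    deriv (alphaF n c) x = (1 - v ^ 2) / (w ^ 2 - v ^ 2) := by
  have hw : 0 < w := by linarith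
  have hn' : (n : ℝ) = w ^ 2 + 1 := by linarith
  have hwv : 0 < w - v := by linarith
  have hx0 : 0 < x := by rw [hx]; positivity
  have h1 : w ^ 2 - v ^ 2 ≠ 0 := by nlinarith
  rw [(hasDerivAt_alphaF (by nlinarith) hc hx0).deriv, hn, sqrt_param hc hv hvw.le hx, hx, hn']
  field_simp
  ring

lemma deriv_deriv_alphaF_param {n : ℕ} {w c v x : ℝ} (hn : (n : ℝ) - 1 = w ^ 2) (hc : 0 < c)
    (hv : 0 < v) (hvw : v < w) (hx : x = c * w * (w - v) ^ 2 / v) :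
    deriv (deriv (alphaF n c)) x =
      2 * (w ^ 2 - 1) * v ^ 3 / (c * w * (w ^ 2 - v ^ 2) ^ 3) := by
  have hw : 0 < w := by linarith
  have hn' : (n : ℝ) = w ^ 2 + 1 := by linarith
  have hwv : 0 < w - v := by linarith
  have hx0 : 0 < x := by rw [hx]; positivity
  have h1 : w ^ 2 - v ^ 2 ≠ 0 := by nlinarith
  have hev : deriv (alphaF n c) =ᶠ[nhds x] fun t => (n : ℝ) / (2 * ((n : ℝ) - 1)) -
      (((n : ℝ) - 2) / (2 * ((n : ℝ) - 1))) * ((2 * t + 4 * ((n : ℝ) - 1) * c) /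
        (2 * Real.sqrt (t ^ 2 + 4 * ((n : ℝ) - 1) * c * t))) := by
    filter_upwards [lt_mem_nhds hx0] with t ht
    exact (hasDerivAt_alphaF (by nlinarith) hc ht).deriv
  rw [hev.deriv_eq]
  have hm : 0 < (n : ℝ) - 1 := by rw [hn]; positivity
  have hs := hasDerivAt_sqrt_quadratic (a := 4 * ((n : ℝ) - 1) * c) (x := x) (by positivity)
  have hnum : HasDerivAt (fun t : ℝ => 2 * t + 4 * ((n : ℝ) - 1) * c) 2 x := by
    simpa using ((hasDerivAt_id x).const_mul 2).add_const (4 * ((n : ℝ) - 1) * c)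
  have h := ((hnum.div (hs.const_mul 2) (by positivity)).const_mul
    (((n : ℝ) - 2) / (2 * ((n : ℝ) - 1)))).const_sub ((n : ℝ) / (2 * ((n : ℝ) - 1)))
  refine h.deriv.trans ?_
  rw [hn, sqrt_param hc hv hvw.le hx, hx, hn']
  field_simp
  ring

lemma sqrt_three_div_two_lt_cos_arctan_div_three (t : ℝ) :
    Real.sqrt 3 / 2 < Real.cos ((1 / 3) * Real.arctan t) := by
  rw [← Real.cos_pi_div_six, ← Real.cos_abs (1 / 3 * Real.arctan t)]
  have h1 := Real.arctan_lt_pi_div_two t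
  have h2 := Real.neg_pi_div_two_lt_arctan t
  have hpi := Real.pi_pos
  refine Real.cos_lt_cos_of_nonneg_of_le_pi (abs_nonneg _) (by linarith) ?_
  rw [abs_lt]
  constructor <;> linarith

lemma yn_le {n : ℕ} (hn : 3 ≤ n) :
    yn n ≤ 4 * (1 - (n : ℝ)) + 2 * ((n : ℝ) ^ 2 - 4) / Real.sqrt (2 * (n : ℝ) - 5) := by
  have hn' : (3 : ℝ) ≤ n := by exact_mod_cast hn
  have h : 0 ≤ 2 * ((n : ℝ) ^ 2 - 4) / Real.sqrt (2 * (n : ℝ) - 5) :=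
    div_nonneg (by nlinarith) (Real.sqrt_nonneg _)
  have := mul_le_mul_of_nonneg_left (Real.cos_le_one ((1 / 3) *
    Real.arctan (((n : ℝ) ^ 2 - 4 * (n : ℝ) + 6) /
      (2 * ((n : ℝ) - 1) * Real.sqrt (2 * (n : ℝ) - 5))))) h
  rw [yn]
  linarith

lemma yn_pos {n : ℕ} (hn : 3 ≤ n) : 0 < yn n := by
  have hn' : (3 : ℝ) ≤ n := by exact_mod_cast hn
  have hs : 0 < Real.sqrt (2 * (n : ℝ) - 5) := Real.sqrt_pos.2 (by linarith)
  have hs2 : Real.sqrt (2 * (n : ℝ) - 5) ^ 2 = 2 * (n : ℝ) - 5 := Real.sq_sqrt (by linarith)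
  have h3 : Real.sqrt 3 ^ 2 = 3 := Real.sq_sqrt (by norm_num)
  have hk : 0 < 2 * ((n : ℝ) ^ 2 - 4) / Real.sqrt (2 * (n : ℝ) - 5) :=
    div_pos (by nlinarith) hs
  have hlt := mul_lt_mul_of_pos_left (sqrt_three_div_two_lt_cos_arctan_div_three
    (((n : ℝ) ^ 2 - 4 * (n : ℝ) + 6) /
      (2 * ((n : ℝ) - 1) * Real.sqrt (2 * (n : ℝ) - 5)))) hk
  have hle : 4 * ((n : ℝ) - 1) ≤
      2 * ((n : ℝ) ^ 2 - 4) / Real.sqrt (2 * (n : ℝ) - 5) * (Real.sqrt 3 / 2) := by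
    rw [div_mul_eq_mul_div, le_div_iff₀ hs]
    have hnn : 0 ≤ 2 * ((n : ℝ) ^ 2 - 4) * (Real.sqrt 3 / 2) :=
      mul_nonneg (by nlinarith) (by positivity)
    refine le_of_sq_le_sq ?_ hnn
    rw [mul_pow, mul_pow, hs2, mul_pow, div_pow, h3]
    obtain ⟨t, ht, htn⟩ : ∃ t : ℝ, 0 ≤ t ∧ (n : ℝ) = 3 + t := ⟨n - 3, by linarith, by ring⟩
    rw [htn]
    nlinarith [mul_nonneg (sq_nonneg (t - 1)) ht, sq_nonneg (t - 1),
      mul_nonneg (sq_nonneg (t - 1)) (sq_nonneg t)]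
  rw [yn]
  linarith

lemma le_of_param_le {w c a v : ℝ} (hw : 0 < w) (hc : 0 < c) (hv : 0 < v) (ha : 0 < a)
    (haw : a ≤ w) (h : c * w * (w - v) ^ 2 / v ≤ c * w * (w - a) ^ 2 / a) : a ≤ v := by
  by_contra! hlt
  rw [div_le_div_iff₀ hv ha, mul_assoc, mul_assoc (c * w)] at h
  have h' := le_of_mul_le_mul_left h (by positivity)
  have : (a - v) * (w ^ 2 - a * v) ≤ 0 := by nlinarith
  have : 0 < (a - v) * (w ^ 2 - a * v) := mul_pos (by linarith) (by nlinarith)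
  linarith

lemma two_mul_div_sqrt_le {w : ℝ} (hw : 173 / 100 ≤ w) (hw3 : 3 ≤ w ^ 2) :
    2 * ((w ^ 2 + 1) ^ 2 - 4) / Real.sqrt (2 * (w ^ 2 + 1) - 5) ≤
      4 * w ^ 2 + w * (w - 7 / 10) ^ 2 / (7 / 10) := by
  have hs : 0 < Real.sqrt (2 * (w ^ 2 + 1) - 5) := Real.sqrt_pos.2 (by linarith)
  have hs2 : Real.sqrt (2 * (w ^ 2 + 1) - 5) ^ 2 = 2 * (w ^ 2 + 1) - 5 :=
    Real.sq_sqrt (by linarith)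
  rw [div_le_iff₀ hs]
  refine le_of_sq_le_sq ?_ (by positivity)
  rw [mul_pow _ (Real.sqrt _), hs2]
  obtain ⟨t, ht, rfl⟩ : ∃ t : ℝ, 0 ≤ t ∧ w = 173 / 100 + t := ⟨w - 173 / 100, by linarith, by ring⟩
  rw [← sub_nonneg]
  ring_nf
  positivity

lemma discriminant_bound {w v : ℝ} (hw : 3 ≤ w ^ 2) (hv : 7 / 10 ≤ v) :
    (1 - v ^ 2) ^ 2 * (w ^ 2 - v ^ 2) <
      4 * (w ^ 2 - 1) * v ^ 3 * (v + 1 / v - 9 / 5) := by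
  have hv0 : 0 < v := by linarith
  have hQ : 18 / 100 < 3 * v ^ 4 - 36 / 5 * v ^ 3 + 6 * v ^ 2 - 1 := by
    obtain ⟨t, ht, rfl⟩ : ∃ t : ℝ, 0 ≤ t ∧ v = 7 / 10 + t := ⟨v - 7 / 10, by linarith, by ring⟩
    nlinarith [mul_nonneg ht (sq_nonneg (t - 1 / 10)), sq_nonneg (t ^ 2 - t / 5),
      mul_nonneg ht (sq_nonneg (t - 1 / 5)), sq_nonneg t]
  have hR : (1 - v ^ 2) ^ 3 < 36 / 100 := by
    have h1 : 1 - v ^ 2 ≤ 51 / 100 := by nlinarith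
    nlinarith [sq_nonneg (1 - v ^ 2), sq_nonneg (1 - v ^ 2 + 51 / 100),
      mul_nonneg (sub_nonneg.2 h1) (sq_nonneg (1 - v ^ 2 + 51 / 200)), sub_nonneg.2 h1]
  have hexp : 4 * (w ^ 2 - 1) * v ^ 3 * (v + 1 / v - 9 / 5) =
      4 * (w ^ 2 - 1) * (v ^ 4 + v ^ 2 - 9 / 5 * v ^ 3) := by
    field_simp
  rw [hexp]
  nlinarith [mul_le_mul_of_nonneg_right (by linarith : 2 ≤ w ^ 2 - 1)
    (by linarith : 0 ≤ 3 * v ^ 4 - 36 / 5 * v ^ 3 + 6 * v ^ 2 - 1)]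

lemma lt_quadratic_of_discrim {A B D T d : ℝ} (hD : 0 < D) (h : B ^ 2 < 2 * D * (A - T)) :
    T < A + B * d + (1 / 2) * D * d ^ 2 := by
  have : 0 < 2 * D * (A + B * d + (1 / 2) * D * d ^ 2 - T) := by
    nlinarith [sq_nonneg (B + D * d)]
  linarith [pos_of_mul_pos_right this (by positivity)]

lemma two_le_add_inv {v : ℝ} (hv : 0 < v) : 2 ≤ v + 1 / v := by
  have h : v + 1 / v - 2 = (v - 1) ^ 2 / v := by field_simp; ring
  have : 0 ≤ (v - 1) ^ 2 / v := by positivity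
  linarith

theorem stmt_9 (n : ℕ) (hn : 3 ≤ n) (c : ℝ) (hc : 0 < c) (x : ℝ) (hx : 0 ≤ x) :
    gammaF n c x > (9 / 5) * Real.sqrt ((n : ℝ) - 1) * c := by
  have hn' : (3 : ℝ) ≤ n := by exact_mod_cast hn
  have hw2 : (n : ℝ) - 1 = Real.sqrt ((n : ℝ) - 1) ^ 2 := (Real.sq_sqrt (by linarith)).symm
  have hw : 0 < Real.sqrt ((n : ℝ) - 1) := Real.sqrt_pos.2 (by linarith)
  set w := Real.sqrt ((n : ℝ) - 1)
  have hcw : 0 < c * w := by positivity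
  unfold gammaF
  split_ifs with hx0
  · obtain ⟨v, hv, hvw, hxv⟩ := exists_param hw hc hx
    rw [alphaF_param hw2 hc hv hvw hxv]
    nlinarith [two_le_add_inv hv]
  · have hpos : 0 < x0 n c := mul_pos (yn_pos hn) hc
    obtain ⟨v, hv, hvw, hxv⟩ := exists_param hw hc hpos.le
    have hvw : v < w := by
      refine lt_of_le_of_ne hvw ?_
      rintro rfl
      simp only [sub_self] at hxv
      norm_num at hxv
      exact hpos.ne' hxv
    have hd : 0 < w ^ 2 - v ^ 2 := by nlinarith
    have hw1 : 0 < w ^ 2 - 1 := by linarith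
    have hyle := yn_le hn
    have hD : 0 < 2 * (w ^ 2 - 1) * v ^ 3 / (c * w * (w ^ 2 - v ^ 2) ^ 3) := by positivity
    rw [betaF, alphaF_param hw2 hc hv hvw.le hxv, deriv_alphaF_param hw2 hc hv hvw hxv,
      deriv_deriv_alphaF_param hw2 hc hv hvw hxv]
    rcases eq_or_lt_of_le hn with rfl | hn4
    · norm_num at hyle hw2
      have hw_lo : 1.414 < w := by nlinarith
      have hw_hi : w < 1.4143 := by nlinarith
      have hx2 : x0 3 c ≤ 2 * c := by unfold x0; nlinarith
      have hv_lo : 0.535 ≤ v := by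
        by_contra! hlt
        rw [hxv, div_le_iff₀ hv] at hx2
        have h1 : w * (w - v) ^ 2 ≤ 2 * v :=
          le_of_mul_le_mul_left (by linarith) hc
        nlinarith [mul_pos hw hv]
      have hkey : 9 / 5 * w * c < c * w * (v + 1 / v) +
          (1 - v ^ 2) / (w ^ 2 - v ^ 2) * (0 - x0 3 c) := by
        have heq : c * w * (v + 1 / v) + (1 - v ^ 2) / (w ^ 2 - v ^ 2) * (0 - x0 3 c) =
            2 * (c * w) * ((w * v + 1) / (w + v)) := by
          rw [hxv]
          have : w + v ≠ 0 := by positivity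
          have : w - v ≠ 0 := by linarith
          rw [show w ^ 2 - v ^ 2 = (w - v) * (w + v) by ring]
          field_simp
          ring
        have hfrac : 9 / 10 < (w * v + 1) / (w + v) := by
          rw [lt_div_iff₀ (by positivity)]
          nlinarith
        rw [heq]
        nlinarith
      have hquad : 0 ≤ 1 / 2 * (2 * (w ^ 2 - 1) * v ^ 3 / (c * w * (w ^ 2 - v ^ 2) ^ 3)) *
          (x - x0 3 c) ^ 2 := by positivity
      rcases le_total 0 ((1 - v ^ 2) / (w ^ 2 - v ^ 2)) with hB | hB
      · nlinarith [mul_nonneg hB hx]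
      · nlinarith [mul_nonneg_of_nonpos_of_nonpos hB (by linarith : x - x0 3 c ≤ 0),
          two_le_add_inv hv]
    · have hn4' : (4 : ℝ) ≤ n := by exact_mod_cast hn4
      have hw3 : 3 ≤ w ^ 2 := by linarith
      have hw_lo : 173 / 100 ≤ w := by nlinarith
      have hv_lo : 7 / 10 ≤ v := by
        refine le_of_param_le hw hc hv (by norm_num) (by linarith) ?_
        have h := two_mul_div_sqrt_le hw_lo hw3
        rw [show (n : ℝ) = w ^ 2 + 1 by linarith] at hyle
        have hy : yn n ≤ w * (w - 7 / 10) ^ 2 / (7 / 10) := by linarith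
        rw [← hxv, x0]
        calc yn n * c ≤ w * (w - 7 / 10) ^ 2 / (7 / 10) * c := by gcongr
          _ = _ := by ring
      refine lt_quadratic_of_discrim hD ?_
      have h := discriminant_bound hw3 hv_lo
      have heq : 2 * (2 * (w ^ 2 - 1) * v ^ 3 / (c * w * (w ^ 2 - v ^ 2) ^ 3)) *
          (c * w * (v + 1 / v) - 9 / 5 * w * c) =
          4 * (w ^ 2 - 1) * v ^ 3 * (v + 1 / v - 9 / 5) / (w ^ 2 - v ^ 2) ^ 3 := by
        field_simp
        ring
      rw [heq, div_pow, div_lt_div_iff₀ (by positivity) (by positivity)]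
      nlinarith [mul_lt_mul_of_pos_right h (pow_pos hd 2)]
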